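/- Let n ≥ 2, b > 0, and let f : ℝⁿ₊ → ℝ be bounded and measurable with support contained in B₁(0). Let u = T_b f. Then u is infinitely differentiable on the set {x in the closed half-space : |x| > 2}, and for every multi-index order k ∈ ℕ there exists a constant C, depending only on n, k, b, such that ‖D^k u(x)‖ ≤ C·‖f‖_{L¹_{μ_b}(ℝⁿ₊)} / |x|^{n−2+b+k} for all x in the closed half-space with |x| > 2. -/

import Mathlib

open MeasureTheory
open scoped ENNReal

noncomputable section

/-- Euclidean n-space. -/
abbrev Eu (n : ℕ) := EuclideanSpace ℝ (Fin n)

/-- Partial derivative ∂ψ/∂xᵢ. -/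
def pd {n : ℕ} (ψ : Eu n → ℝ) (i : Fin n) (x : Eu n) : ℝ :=
  fderiv ℝ ψ x (EuclideanSpace.single i 1)

/-- Second partial derivative ∂²ψ/∂xᵢ∂xⱼ. -/
def pd2 {n : ℕ} (ψ : Eu n → ℝ) (i j : Fin n) (x : Eu n) : ℝ :=
  pd (pd ψ j) i x


/-- The constant `D_b = 2^{b-2} π^{-n/2} Γ((n+b-2)/2)/Γ(b/2)`. -/
def Db (n : ℕ) (b : ℝ) : ℝ :=
  2 ^ (b - 2) * Real.pi ^ (-(n : ℝ) / 2) *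
    Real.Gamma (((n : ℝ) + b - 2) / 2) / Real.Gamma (b / 2)

/-- Reflection `y* = (y₁,…,y_{n-1},−y_n)` across the hyperplane `{y_n = 0}`. -/
def reflLn {n : ℕ} (ln : Fin n) (y : Eu n) : Eu n :=
  (EuclideanSpace.equiv (Fin n) ℝ).symm (fun i => if i = ln then -(y i) else y i)

/-- Horiuchi's Green function `K_b(x,y)`. -/
def Kb (n : ℕ) (ln : Fin n) (b : ℝ) (x y : Eu n) : ℝ :=
  Db n b * ∫ τ in (0 : ℝ)..1,
    (‖x - y‖ ^ 2 * (1 - τ) + ‖x - reflLn ln y‖ ^ 2 * τ) ^ (-(((n : ℝ) - 2 + b) / 2)) *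
      (τ * (1 - τ)) ^ (b / 2 - 1)

/-- The solution operator `T_b f(x) = ∫_{ℝⁿ₊} K_b(x,y) yₙ^b f(y) dy`. -/
def Tb (n : ℕ) (ln : Fin n) (b : ℝ) (f : Eu n → ℝ) (x : Eu n) : ℝ :=
  ∫ y in {y : Eu n | 0 < y ln}, Kb n ln b x y * (y ln) ^ b * f y

/-- The measure `μ_b` on `ℝⁿ₊` with density `xₙ^b` w.r.t. Lebesgue measure. -/
def mub (n : ℕ) (ln : Fin n) (b : ℝ) : Measure (Eu n) :=
  (volume.restrict {x : Eu n | 0 < x ln}).withDensity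
    fun x => ENNReal.ofReal ((x ln) ^ b)

/-- A continuous family of data in a compact set of parameters gives an integrable integrand. -/
theorem integrable_smul_param {E Q F Θ : Type} [TopologicalSpace E] [TopologicalSpace Q]
    [NormedAddCommGroup F] [NormedSpace ℝ F] [TopologicalSpace Θ] [SecondCountableTopology Θ]
    [MeasurableSpace Θ] [OpensMeasurableSpace Θ]
    {G : E × Q → F} {Ω : Set (E × Q)} (hG : ContinuousOn G Ω)
    {K : Set Q} (hK : IsCompact K) {μ : Measure Θ} {s : Set Θ} (hs : MeasurableSet s)
    {p : Θ → Q} (hp : Continuous p) (hps : Set.MapsTo p s K) {h : Θ → ℝ}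
    (hh : IntegrableOn h s μ) {x : E} (hx : ∀ q ∈ K, (x, q) ∈ Ω) :
    IntegrableOn (fun θ => h θ • G (x, p θ)) s μ := by
  have hGK : ContinuousOn (fun q => G (x, q)) K := hG.comp (by fun_prop) hx
  obtain ⟨C, hC⟩ := hK.exists_bound_of_continuousOn hGK
  refine Integrable.smul_bdd hh C ((hGK.comp hp.continuousOn hps).aestronglyMeasurable hs) ?_
  filter_upwards [ae_restrict_mem hs] with θ hθ using hC _ (hps hθ)

section ParametricIntegral

variable {E Q F Θ : Type} [NormedAddCommGroup E] [NormedSpace ℝ E]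
  [NormedAddCommGroup Q] [NormedSpace ℝ Q] [NormedAddCommGroup F] [NormedSpace ℝ F]
  [TopologicalSpace Θ] [SecondCountableTopology Θ] [MeasurableSpace Θ] [OpensMeasurableSpace Θ]

/-- The partial derivative of `G : E × Q → F` in the first variable. -/
def partialFDeriv (G : E × Q → F) (z : E × Q) : E →L[ℝ] F :=
  (fderiv ℝ G z).comp (ContinuousLinearMap.inl ℝ E Q)

theorem ContDiffOn.partialFDeriv {G : E × Q → F} {Ω : Set (E × Q)}
    (hG : ContDiffOn ℝ (⊤ : ℕ∞) G Ω) (hΩ : IsOpen Ω) :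
    ContDiffOn ℝ (⊤ : ℕ∞) (partialFDeriv G) Ω :=
  ((contDiffOn_infty_iff_fderiv_of_isOpen hΩ).1 hG).2.clm_comp contDiffOn_const

theorem hasFDerivAt_partialFDeriv {G : E × Q → F} {Ω : Set (E × Q)}
    (hG : ContDiffOn ℝ (⊤ : ℕ∞) G Ω) (hΩ : IsOpen Ω) {x : E} {q : Q} (hx : (x, q) ∈ Ω) :
    HasFDerivAt (fun z => G (z, q)) (partialFDeriv G (x, q)) x :=
  (((hG.contDiffAt (hΩ.mem_nhds hx)).differentiableAt (by simp)).hasFDerivAt).comp x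
    (hasFDerivAt_prodMk_left x q)

variable [FiniteDimensional ℝ E]

theorem hasFDerivAt_integral_param {G : E × Q → F} {Ω : Set (E × Q)}
    (hG : ContDiffOn ℝ (⊤ : ℕ∞) G Ω) (hΩ : IsOpen Ω)
    {U : Set E} (hU : IsOpen U) {K : Set Q} (hK : IsCompact K) (hUK : U ×ˢ K ⊆ Ω)
    {μ : Measure Θ} {s : Set Θ} (hs : MeasurableSet s)
    {p : Θ → Q} (hp : Continuous p) (hps : Set.MapsTo p s K) {h : Θ → ℝ}
    (hh : IntegrableOn h s μ) {x : E} (hx : x ∈ U) :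
    HasFDerivAt (fun z => ∫ θ in s, h θ • G (z, p θ) ∂μ)
      (∫ θ in s, h θ • partialFDeriv G (x, p θ) ∂μ) x := by
  have := FiniteDimensional.proper_real E
  obtain ⟨ε, hε, hεU⟩ := Metric.nhds_basis_closedBall.mem_iff.1 (hU.mem_nhds hx)
  have hG' := (hG.partialFDeriv hΩ).continuousOn
  obtain ⟨C, hC⟩ := ((isCompact_closedBall x ε).prod hK).exists_bound_of_continuousOn
    (hG'.mono ((Set.prod_mono_left hεU).trans hUK))
  refine hasFDerivAt_integral_of_dominated_of_fderiv_le (bound := fun θ => ‖h θ‖ * C)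
    (F' := fun z θ => h θ • partialFDeriv G (z, p θ))
    (Metric.closedBall_mem_nhds x hε) ?_ ?_ ?_ ?_ ?_ ?_
  · filter_upwards [hU.mem_nhds hx] with z hz
    exact (integrable_smul_param hG.continuousOn hK hs hp hps hh
      fun q hq => hUK ⟨hz, hq⟩).aestronglyMeasurable
  · exact integrable_smul_param hG.continuousOn hK hs hp hps hh fun q hq => hUK ⟨hx, hq⟩
  · exact (integrable_smul_param hG' hK hs hp hps hh
      fun q hq => hUK ⟨hx, hq⟩).aestronglyMeasurable
  · filter_upwards [ae_restrict_mem hs] with θ hθ z hz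
    rw [norm_smul]
    exact mul_le_mul_of_nonneg_left (hC (z, p θ) ⟨hz, hps hθ⟩) (norm_nonneg _)
  · exact hh.norm.mul_const C
  · filter_upwards [ae_restrict_mem hs] with θ hθ z hz
    exact (hasFDerivAt_partialFDeriv hG hΩ (hUK ⟨hεU hz, hps hθ⟩)).const_smul (h θ)

theorem contDiffOn_integral_param {G : E × Q → F} {Ω : Set (E × Q)}
    (hG : ContDiffOn ℝ (⊤ : ℕ∞) G Ω) (hΩ : IsOpen Ω)
    {U : Set E} (hU : IsOpen U) {K : Set Q} (hK : IsCompact K) (hUK : U ×ˢ K ⊆ Ω)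
    {μ : Measure Θ} {s : Set Θ} (hs : MeasurableSet s)
    {p : Θ → Q} (hp : Continuous p) (hps : Set.MapsTo p s K) {h : Θ → ℝ}
    (hh : IntegrableOn h s μ) :
    ContDiffOn ℝ (⊤ : ℕ∞) (fun z => ∫ θ in s, h θ • G (z, p θ) ∂μ) U := by
  refine contDiffOn_infty.2 fun k => ?_
  induction k generalizing F with
  | zero =>
    exact contDiffOn_zero.2 fun x hx => (hasFDerivAt_integral_param hG hΩ hU hK hUK hs hp hps hh
      hx).continuousAt.continuousWithinAt
  | succ k ih =>
    have hd := fun x hx => hasFDerivAt_integral_param hG hΩ hU hK hUK hs hp hps hh (x := x) hx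
    refine (contDiffOn_succ_iff_fderiv_of_isOpen (n := (k : WithTop ℕ∞)) hU).2
      ⟨fun x hx => (hd x hx).differentiableAt.differentiableWithinAt, by simp, ?_⟩
    exact (ih (hG.partialFDeriv hΩ)).congr fun x hx => (hd x hx).fderiv

/-- The derivatives of a parametric integral are bounded, on compact sets, by a multiple of the
`L¹` norm of the weight, uniformly in the weight and in the family of parameters. -/
theorem exists_norm_iteratedFDeriv_integral_param_le (k : ℕ) {G : E × Q → F} {Ω : Set (E × Q)}
    (hG : ContDiffOn ℝ (⊤ : ℕ∞) G Ω) (hΩ : IsOpen Ω)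
    {U : Set E} (hU : IsOpen U) {K : Set Q} (hK : IsCompact K) (hUK : U ×ˢ K ⊆ Ω)
    {S : Set E} (hS : IsCompact S) (hSU : S ⊆ U)
    (μ : Measure Θ) {s : Set Θ} (hs : MeasurableSet s) :
    ∃ C : ℝ, ∀ p : Θ → Q, Continuous p → Set.MapsTo p s K → ∀ h : Θ → ℝ, IntegrableOn h s μ →
      ∀ x ∈ S, ‖iteratedFDeriv ℝ k (fun z => ∫ θ in s, h θ • G (z, p θ) ∂μ) x‖ ≤
        C * ∫ θ in s, ‖h θ‖ ∂μ := by
  induction k generalizing F with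
  | zero =>
    obtain ⟨C, hC⟩ := (hS.prod hK).exists_bound_of_continuousOn
      (hG.continuousOn.mono ((Set.prod_mono_left hSU).trans hUK))
    refine ⟨C, fun p _ hps h hh x hx => ?_⟩
    rw [norm_iteratedFDeriv_zero, ← integral_const_mul]
    refine norm_integral_le_of_norm_le (hh.norm.const_mul C) ?_
    filter_upwards [ae_restrict_mem hs] with θ hθ
    rw [norm_smul, mul_comm]
    exact mul_le_mul_of_nonneg_right (hC (x, p θ) ⟨hx, hps hθ⟩) (norm_nonneg _)
  | succ k ih =>
    obtain ⟨C, hC⟩ := ih (hG.partialFDeriv hΩ)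
    refine ⟨C, fun p hp hps h hh x hx => ?_⟩
    have hd : fderiv ℝ (fun z => ∫ θ in s, h θ • G (z, p θ) ∂μ) =ᶠ[nhds x]
        fun z => ∫ θ in s, h θ • partialFDeriv G (z, p θ) ∂μ := by
      filter_upwards [hU.mem_nhds (hSU hx)] with z hz
      exact (hasFDerivAt_integral_param hG hΩ hU hK hUK hs hp hps hh hz).fderiv
    rw [← norm_iteratedFDeriv_fderiv, (hd.iteratedFDeriv ℝ k).eq_of_nhds]
    exact hC p hp hps h hh x hx

end ParametricIntegral

/-- Derivatives of `x ↦ c • g (r⁻¹ • x)`. -/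
theorem norm_iteratedFDeriv_comp_inv_smul {E F : Type} [NormedAddCommGroup E] [NormedSpace ℝ E]
    [NormedAddCommGroup F] [NormedSpace ℝ F] (k : ℕ) {g : E → F} (a c : ℝ) (x : E) :
    ‖iteratedFDeriv ℝ k (fun z => c • g (a • z)) x‖ =
      |c| * |a| ^ k * ‖iteratedFDeriv ℝ k g (a • x)‖ := by
  induction k generalizing F c with
  | zero => simp [norm_smul]
  | succ k ih =>
    rw [← norm_iteratedFDeriv_fderiv, ← norm_iteratedFDeriv_fderiv]
    have : fderiv ℝ (fun z => c • g (a • z)) = fun z => (c * a) • fderiv ℝ g (a • z) := by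
      ext1 z
      have := fderiv_comp_smul (𝕜 := ℝ) (f := g) (x := z) a
      rw [← smul_smul, ← this]
      exact congrFun (fderiv_const_smul_field (𝕜 := ℝ) c) z
    rw [this, ih, abs_mul, pow_succ]
    ring

theorem reflLn_smul {n : ℕ} (ln : Fin n) (c : ℝ) (y : Eu n) :
    reflLn ln (c • y) = c • reflLn ln y := by
  ext i
  by_cases hi : i = ln <;> simp [reflLn, hi]

theorem norm_reflLn {n : ℕ} (ln : Fin n) (y : Eu n) : ‖reflLn ln y‖ = ‖y‖ := by
  simp only [EuclideanSpace.norm_eq, reflLn]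
  congr 2 with i
  by_cases hi : i = ln <;> simp [hi]

theorem contDiff_reflLn {n : ℕ} (ln : Fin n) : ContDiff ℝ (⊤ : ℕ∞) (reflLn ln) := by
  refine (EuclideanSpace.equiv (Fin n) ℝ).symm.contDiff.comp (contDiff_pi.2 fun i => ?_)
  by_cases hi : i = ln <;> simp only [hi, if_true, if_false] <;> fun_prop

/-- The interpolation `|x-y|²(1-τ) + |x-y*|²τ` of squared distances in `Kb`, as a function of
`(x, (y, τ))`. -/
def interpSq {n : ℕ} (ln : Fin n) (z : Eu n × Eu n × ℝ) : ℝ :=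
  ‖z.1 - z.2.1‖ ^ 2 * (1 - z.2.2) + ‖z.1 - reflLn ln z.2.1‖ ^ 2 * z.2.2

theorem contDiff_interpSq {n : ℕ} (ln : Fin n) :
    ContDiff ℝ (⊤ : ℕ∞) (interpSq ln) := by
  have h1 : ContDiff ℝ (⊤ : ℕ∞) fun z : Eu n × Eu n × ℝ => z.1 - z.2.1 := by fun_prop
  have h2 : ContDiff ℝ (⊤ : ℕ∞) fun z : Eu n × Eu n × ℝ => z.1 - reflLn ln z.2.1 :=
    contDiff_fst.sub ((contDiff_reflLn ln).comp (contDiff_fst.comp contDiff_snd))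
  have h3 : ContDiff ℝ (⊤ : ℕ∞) fun z : Eu n × Eu n × ℝ => z.2.2 := by fun_prop
  exact ((h1.norm_sq ℝ).mul (contDiff_const.sub h3)).add ((h2.norm_sq ℝ).mul h3)

theorem interpSq_nonneg {n : ℕ} (ln : Fin n) (x y : Eu n) {τ : ℝ} (hτ : τ ∈ Set.Icc (0 : ℝ) 1) :
    0 ≤ interpSq ln (x, y, τ) :=
  add_nonneg (mul_nonneg (sq_nonneg _) (sub_nonneg.2 hτ.2)) (mul_nonneg (sq_nonneg _) hτ.1)

theorem interpSq_pos {n : ℕ} (ln : Fin n) {x y : Eu n} (hxy : ‖y‖ < ‖x‖) {τ : ℝ}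
    (hτ : τ ∈ Set.Icc (0 : ℝ) 1) : 0 < interpSq ln (x, y, τ) := by
  have key : ∀ w : Eu n, ‖w‖ = ‖y‖ → (‖x‖ - ‖y‖) ^ 2 ≤ ‖x - w‖ ^ 2 := fun w hw =>
    pow_le_pow_left₀ (sub_nonneg.2 hxy.le) (hw ▸ norm_sub_norm_le x w) 2
  have h0 : 0 < (‖x‖ - ‖y‖) ^ 2 := pow_pos (sub_pos.2 hxy) 2
  have h1 := mul_le_mul_of_nonneg_right (key y rfl) (sub_nonneg.2 hτ.2)
  have h2 := mul_le_mul_of_nonneg_right (key _ (norm_reflLn ln y)) hτ.1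
  simp only [interpSq]
  linarith

theorem interpSq_smul {n : ℕ} (ln : Fin n) (c : ℝ) (x y : Eu n) (τ : ℝ) :
    interpSq ln (c • x, c • y, τ) = c ^ 2 * interpSq ln (x, y, τ) := by
  simp only [interpSq, reflLn_smul, ← smul_sub, norm_smul, mul_pow, Real.norm_eq_abs, sq_abs]
  ring

theorem contDiffOn_interpSq_rpow {n : ℕ} (ln : Fin n) (a : ℝ) :
    ContDiffOn ℝ (⊤ : ℕ∞) (fun z => interpSq ln z ^ a) {z | 0 < interpSq ln z} :=
  (contDiff_interpSq ln).contDiffOn.rpow_const_of_ne fun _ hz => ne_of_gt hz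

theorem integrableOn_beta_weight {b : ℝ} (hb : 0 < b) :
    IntegrableOn (fun τ : ℝ => (τ * (1 - τ)) ^ (b / 2 - 1)) (Set.Ioc 0 1) := by
  have h := Complex.betaIntegral_convergent (u := (b / 2 : ℝ)) (v := (b / 2 : ℝ))
    (by simpa using hb) (by simpa using hb)
  rw [intervalIntegrable_iff_integrableOn_Ioc_of_le zero_le_one] at h
  refine (IntegrableOn.congr_fun (Integrable.re h) (fun τ hτ => ?_) measurableSet_Ioc)
  rw [Real.mul_rpow hτ.1.le (sub_nonneg.2 hτ.2), ← Complex.ofReal_one, ← Complex.ofReal_sub,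
    ← Complex.ofReal_sub, ← Complex.ofReal_cpow hτ.1.le,
    ← Complex.ofReal_cpow (sub_nonneg.2 hτ.2), ← Complex.ofReal_mul]
  exact Complex.ofReal_re _

/-- The part of the half-space inside the unit ball. -/
def halfBall {n : ℕ} (ln : Fin n) : Set (Eu n) :=
  {y | 0 < y ln} ∩ Metric.ball 0 1

theorem measurableSet_halfSpace {n : ℕ} (ln : Fin n) : MeasurableSet {y : Eu n | 0 < y ln} :=
  (isOpen_lt continuous_const (by fun_prop)).measurableSet

theorem measurableSet_halfBall {n : ℕ} (ln : Fin n) : MeasurableSet (halfBall ln) :=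
  (measurableSet_halfSpace ln).inter measurableSet_ball

theorem setIntegral_halfSpace_eq_halfBall {n : ℕ} (ln : Fin n) {g : Eu n → ℝ}
    (hg : ∀ y, g y ≠ 0 → y ∈ Metric.ball (0 : Eu n) 1) :
    ∫ y in {y : Eu n | 0 < y ln}, g y = ∫ y in halfBall ln, g y :=
  setIntegral_eq_of_subset_of_forall_sdiff_eq_zero (measurableSet_halfSpace ln)
    Set.inter_subset_left fun y hy => by_contra fun h => hy.2 ⟨hy.1, hg y h⟩

/-- The weight of `Tb` on the product of the half-space and the interval. -/
def TbWeight {n : ℕ} (ln : Fin n) (b : ℝ) (f : Eu n → ℝ) (θ : Eu n × ℝ) : ℝ :=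
  (θ.1 ln) ^ b * f θ.1 * (θ.2 * (1 - θ.2)) ^ (b / 2 - 1)

theorem integrableOn_rpow_mul {n : ℕ} (ln : Fin n) {b : ℝ} (hb : 0 < b) {f : Eu n → ℝ}
    (hf : Measurable f) {M : ℝ} (hM : ∀ y, |f y| ≤ M) :
    IntegrableOn (fun y : Eu n => (y ln) ^ b * f y) (halfBall ln) := by
  refine Measure.integrableOn_of_bounded (M := M) ?_ ?_ ?_
  · exact ((measure_mono Set.inter_subset_right).trans_lt measure_ball_lt_top).ne
  · exact (Measurable.mul (by fun_prop) hf).aestronglyMeasurable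
  · filter_upwards [ae_restrict_mem (measurableSet_halfBall ln)] with y hy
    have h0 : 0 < y ln := hy.1
    have h1 : y ln ≤ 1 := by
      have := (le_abs_self _).trans (PiLp.norm_apply_le y ln)
      exact this.trans (mem_ball_zero_iff.1 hy.2).le
    rw [norm_mul, Real.norm_of_nonneg (Real.rpow_nonneg h0.le b)]
    exact (mul_le_of_le_one_left (norm_nonneg _) (Real.rpow_le_one h0.le h1 hb.le)).trans (hM y)

theorem integrableOn_TbWeight {n : ℕ} (ln : Fin n) {b : ℝ} (hb : 0 < b) {f : Eu n → ℝ}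
    (hf : Measurable f) {M : ℝ} (hM : ∀ y, |f y| ≤ M) :
    IntegrableOn (TbWeight ln b f) (halfBall ln ×ˢ Set.Ioc 0 1) := by
  have := Integrable.mul_prod (integrableOn_rpow_mul ln hb hf hM) (integrableOn_beta_weight hb)
  rwa [Measure.prod_restrict] at this

theorem integral_norm_TbWeight {n : ℕ} (ln : Fin n) (b : ℝ) {f : Eu n → ℝ}
    (hf : ∀ y, f y ≠ 0 → y ∈ Metric.ball (0 : Eu n) 1) :
    ∫ θ in halfBall ln ×ˢ Set.Ioc 0 1, ‖TbWeight ln b f θ‖ =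
      (∫ y in {y : Eu n | 0 < y ln}, |f y| * (y ln) ^ b) *
        ∫ τ in Set.Ioc (0 : ℝ) 1, ‖(τ * (1 - τ)) ^ (b / 2 - 1)‖ := by
  rw [setIntegral_halfSpace_eq_halfBall ln fun y hy => hf y fun h => hy (by simp [h])]
  simp only [TbWeight, norm_mul _ (_ ^ (b / 2 - 1))]
  rw [Measure.volume_eq_prod, setIntegral_prod_mul
    (fun y : Eu n => ‖(y ln) ^ b * f y‖) fun τ : ℝ => ‖(τ * (1 - τ)) ^ (b / 2 - 1)‖]
  congr 1
  refine setIntegral_congr_fun (measurableSet_halfBall ln) fun y hy => ?_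
  have h0 : 0 < y ln := hy.1
  simp only [norm_mul, Real.norm_eq_abs]
  rw [abs_of_nonneg (Real.rpow_nonneg h0.le b), mul_comm]

theorem prod_closedBall_Icc_subset {n : ℕ} (ln : Fin n) :
    {x : Eu n | 1 / 2 < ‖x‖} ×ˢ (Metric.closedBall (0 : Eu n) (1 / 2) ×ˢ Set.Icc (0 : ℝ) 1) ⊆
      {z | 0 < interpSq ln z} := fun _ hz =>
  interpSq_pos ln ((mem_closedBall_zero_iff.1 hz.2.1).trans_lt hz.1) hz.2.2

theorem mapsTo_inv_smul {n : ℕ} (ln : Fin n) {r : ℝ} (hr : 2 < r) :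
    Set.MapsTo (fun θ : Eu n × ℝ => (r⁻¹ • θ.1, θ.2)) (halfBall ln ×ˢ Set.Ioc 0 1)
      (Metric.closedBall (0 : Eu n) (1 / 2) ×ˢ Set.Icc (0 : ℝ) 1) := by
  intro θ hθ
  refine ⟨mem_closedBall_zero_iff.2 ?_, Set.Ioc_subset_Icc_self hθ.2⟩
  have h1 := mem_ball_zero_iff.1 hθ.1.2
  have h2 : r⁻¹ ≤ 1 / 2 := by rw [one_div]; exact inv_anti₀ two_pos hr.le
  rw [norm_smul, Real.norm_of_nonneg (inv_nonneg.2 (two_pos.trans hr).le)]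
  calc r⁻¹ * ‖θ.1‖ ≤ 1 / 2 * 1 := by gcongr
    _ = 1 / 2 := mul_one _

/-- `Tb f` at scale `r`, with the parameters of the kernel in a fixed compact set. -/
def rescaledTb {n : ℕ} (ln : Fin n) (b : ℝ) (f : Eu n → ℝ) (r : ℝ) (x : Eu n) : ℝ :=
  ∫ θ in halfBall ln ×ˢ Set.Ioc 0 1, TbWeight ln b f θ •
    interpSq ln (x, r⁻¹ • θ.1, θ.2) ^ (-(((n : ℝ) - 2 + b) / 2))

theorem isOpen_setOf_lt_norm {n : ℕ} (c : ℝ) : IsOpen {x : Eu n | c < ‖x‖} :=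
  isOpen_lt continuous_const continuous_norm

theorem isOpen_setOf_interpSq_pos {n : ℕ} (ln : Fin n) : IsOpen {z | 0 < interpSq ln z} :=
  isOpen_lt continuous_const (contDiff_interpSq ln).continuous

theorem isCompact_params (n : ℕ) :
    IsCompact (Metric.closedBall (0 : Eu n) (1 / 2) ×ˢ Set.Icc (0 : ℝ) 1) :=
  (isCompact_closedBall _ _).prod isCompact_Icc

theorem measurableSet_halfBall_prod {n : ℕ} (ln : Fin n) :
    MeasurableSet (halfBall ln ×ˢ Set.Ioc (0 : ℝ) 1) :=
  (measurableSet_halfBall ln).prod measurableSet_Ioc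

theorem contDiffOn_rescaledTb {n : ℕ} (ln : Fin n) {b : ℝ} (hb : 0 < b) {f : Eu n → ℝ}
    (hf : Measurable f) {M : ℝ} (hM : ∀ y, |f y| ≤ M) {r : ℝ} (hr : 2 < r) :
    ContDiffOn ℝ (⊤ : ℕ∞) (rescaledTb ln b f r) {x | 1 / 2 < ‖x‖} :=
  contDiffOn_integral_param (contDiffOn_interpSq_rpow ln _) (isOpen_setOf_interpSq_pos ln)
    (isOpen_setOf_lt_norm _) (isCompact_params n) (prod_closedBall_Icc_subset ln)
    (measurableSet_halfBall_prod ln) (by fun_prop) (mapsTo_inv_smul ln hr)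
    (integrableOn_TbWeight ln hb hf hM)

theorem exists_norm_iteratedFDeriv_rescaledTb_le {n : ℕ} (ln : Fin n) {b : ℝ} (hb : 0 < b)
    (k : ℕ) : ∃ C : ℝ, ∀ f : Eu n → ℝ, Measurable f → (∃ M : ℝ, ∀ y, |f y| ≤ M) →
      ∀ r : ℝ, 2 < r → ∀ x : Eu n, ‖x‖ = 1 → ‖iteratedFDeriv ℝ k (rescaledTb ln b f r) x‖ ≤
        C * ∫ θ in halfBall ln ×ˢ Set.Ioc 0 1, ‖TbWeight ln b f θ‖ := by
  obtain ⟨C, hC⟩ := exists_norm_iteratedFDeriv_integral_param_le k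
    (contDiffOn_interpSq_rpow ln (-(((n : ℝ) - 2 + b) / 2))) (isOpen_setOf_interpSq_pos ln)
    (isOpen_setOf_lt_norm (1 / 2)) (isCompact_params n) (prod_closedBall_Icc_subset ln)
    (isCompact_sphere (0 : Eu n) 1)
    (fun x hx => by rw [Set.mem_ofPred_eq, mem_sphere_zero_iff_norm.1 hx]; norm_num)
    volume (measurableSet_halfBall_prod ln)
  refine ⟨C, fun f hf ⟨M, hM⟩ r hr x hx => ?_⟩
  exact hC (fun θ => (r⁻¹ • θ.1, θ.2)) (by fun_prop) (mapsTo_inv_smul ln hr) _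
    (integrableOn_TbWeight ln hb hf hM) x (mem_sphere_zero_iff_norm.2 hx)

theorem Tb_eq_rescaledTb {n : ℕ} (ln : Fin n) {b : ℝ} (hb : 0 < b) {f : Eu n → ℝ}
    (hf : Measurable f) {M : ℝ} (hM : ∀ y, |f y| ≤ M)
    (hsupp : ∀ y, f y ≠ 0 → y ∈ Metric.ball (0 : Eu n) 1) {r : ℝ} (hr : 2 < r) {x : Eu n}
    (hx : r / 2 < ‖x‖) :
    Tb n ln b f x = (Db n b * r ^ (-((n : ℝ) - 2 + b))) • rescaledTb ln b f r (r⁻¹ • x) := by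
  have hr0 : 0 < r := two_pos.trans hr
  have hx' : 1 / 2 < ‖r⁻¹ • x‖ := by
    rw [norm_smul, Real.norm_of_nonneg (inv_nonneg.2 hr0.le), inv_mul_eq_div, lt_div_iff₀ hr0]
    linarith
  rw [Tb, setIntegral_halfSpace_eq_halfBall ln fun y hy => hsupp y fun h => hy (by simp [h]),
    rescaledTb, Measure.volume_eq_prod, setIntegral_prod, ← integral_smul]
  · refine setIntegral_congr_fun (measurableSet_halfBall ln) fun y _ => ?_
    simp only [Kb, TbWeight, smul_eq_mul]
    rw [intervalIntegral.integral_of_le zero_le_one, mul_assoc (Db n b * _), mul_assoc (Db n b),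
      mul_assoc (Db n b), ← integral_mul_const, ← integral_const_mul, ← integral_const_mul,
      ← integral_const_mul]
    refine setIntegral_congr_fun measurableSet_Ioc fun τ hτ => ?_
    have hq := interpSq_smul ln r (r⁻¹ • x) (r⁻¹ • y) τ
    rw [smul_inv_smul₀ hr0.ne', smul_inv_smul₀ hr0.ne'] at hq
    have hpow : interpSq ln (x, y, τ) ^ (-(((n : ℝ) - 2 + b) / 2)) =
        r ^ (-((n : ℝ) - 2 + b)) *
          interpSq ln (r⁻¹ • x, r⁻¹ • y, τ) ^ (-(((n : ℝ) - 2 + b) / 2)) := by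
      rw [hq, Real.mul_rpow (sq_nonneg r) (interpSq_nonneg ln _ _ (Set.Ioc_subset_Icc_self hτ)),
        ← Real.rpow_natCast r 2, ← Real.rpow_mul hr0.le]
      congr 2
      push_cast
      ring
    simp only [interpSq] at hpow ⊢
    rw [hpow]
    ring
  · exact integrable_smul_param (contDiffOn_interpSq_rpow ln _).continuousOn (isCompact_params n)
      (measurableSet_halfBall_prod ln) (p := fun θ : Eu n × ℝ => (r⁻¹ • θ.1, θ.2)) (by fun_prop)
      (mapsTo_inv_smul ln hr) (integrableOn_TbWeight ln hb hf hM)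
      fun q hq => prod_closedBall_Icc_subset ln ⟨hx', hq⟩

theorem Tb_eventuallyEq_rescaledTb {n : ℕ} (ln : Fin n) {b : ℝ} (hb : 0 < b) {f : Eu n → ℝ}
    (hf : Measurable f) {M : ℝ} (hM : ∀ y, |f y| ≤ M)
    (hsupp : ∀ y, f y ≠ 0 → y ∈ Metric.ball (0 : Eu n) 1) {x : Eu n} (hx : 2 < ‖x‖) :
    Tb n ln b f =ᶠ[nhds x] fun z =>
      (Db n b * ‖x‖ ^ (-((n : ℝ) - 2 + b))) • rescaledTb ln b f ‖x‖ (‖x‖⁻¹ • z) := by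
  filter_upwards [(isOpen_setOf_lt_norm (n := n) (‖x‖ / 2)).mem_nhds
    (show ‖x‖ / 2 < ‖x‖ by linarith)] with z hz
  exact Tb_eq_rescaledTb ln hb hf hM hsupp hx hz

theorem norm_inv_norm_smul {n : ℕ} {x : Eu n} (hx : 2 < ‖x‖) : ‖‖x‖⁻¹ • x‖ = 1 :=
  norm_smul_inv_norm (𝕜 := ℝ) (norm_pos_iff.1 (two_pos.trans hx))

theorem contDiffAt_Tb {n : ℕ} (ln : Fin n) {b : ℝ} (hb : 0 < b) {f : Eu n → ℝ}
    (hf : Measurable f) {M : ℝ} (hM : ∀ y, |f y| ≤ M)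
    (hsupp : ∀ y, f y ≠ 0 → y ∈ Metric.ball (0 : Eu n) 1) {x : Eu n} (hx : 2 < ‖x‖) :
    ContDiffAt ℝ (⊤ : ℕ∞) (Tb n ln b f) x := by
  refine ContDiffAt.congr_of_eventuallyEq ?_ (Tb_eventuallyEq_rescaledTb ln hb hf hM hsupp hx)
  have hmem : ‖x‖⁻¹ • x ∈ {z : Eu n | 1 / 2 < ‖z‖} := by
    rw [Set.mem_ofPred_eq, norm_inv_norm_smul hx]
    norm_num
  have hscale : ContDiffAt ℝ (⊤ : ℕ∞) (fun z : Eu n => ‖x‖⁻¹ • z) x := by fun_prop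
  have hΦ := (contDiffOn_rescaledTb ln hb hf hM hx).contDiffAt
    ((isOpen_setOf_lt_norm _).mem_nhds hmem)
  exact contDiffAt_const.mul (hΦ.comp x hscale)

theorem uniqueDiffOn_halfSpace_inter {n : ℕ} (ln : Fin n) :
    UniqueDiffOn ℝ {x : Eu n | 0 ≤ x ln ∧ 2 < ‖x‖} := by
  have hconv : Convex ℝ {x : Eu n | 0 ≤ x ln} :=
    convex_halfSpace_ge (EuclideanSpace.proj ln : Eu n →L[ℝ] ℝ).isLinear 0
  refine (uniqueDiffOn_convex hconv ⟨EuclideanSpace.single ln 1, ?_⟩).inter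
    (isOpen_setOf_lt_norm 2)
  have hopen : IsOpen {x : Eu n | 0 < x ln} := isOpen_lt continuous_const (by fun_prop)
  refine interior_mono (s := {x : Eu n | 0 < x ln}) (fun y (hy : 0 < y ln) => hy.le) ?_
  rw [hopen.interior_eq]
  simp

theorem stmt12 (n : ℕ) (hn : 2 ≤ n) (ln : Fin n) (hln : (ln : ℕ) = n - 1)
    (b : ℝ) (hb : 0 < b) :
    -- u = T_b f is smooth on the part of the closed half-space where |x| > 2 …
    (∀ f : Eu n → ℝ, Measurable f → (∃ M : ℝ, ∀ y, |f y| ≤ M) →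
      (∀ y : Eu n, f y ≠ 0 → y ∈ Metric.ball (0 : Eu n) 1) →
      ContDiffOn ℝ (⊤ : ℕ∞) (Tb n ln b f) {x : Eu n | 0 ≤ x ln ∧ 2 < ‖x‖}) ∧
    -- … with derivative decay ‖D^k u(x)‖ ≤ C ‖f‖_{L¹_{μ_b}} / |x|^{n-2+b+k}
    ∀ k : ℕ, ∃ C : ℝ, 0 < C ∧
      ∀ f : Eu n → ℝ, Measurable f → (∃ M : ℝ, ∀ y, |f y| ≤ M) →
        (∀ y : Eu n, f y ≠ 0 → y ∈ Metric.ball (0 : Eu n) 1) →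
        ∀ x : Eu n, 0 ≤ x ln → 2 < ‖x‖ →
          ‖iteratedFDerivWithin ℝ k (Tb n ln b f)
              {z : Eu n | 0 ≤ z ln ∧ 2 < ‖z‖} x‖ ≤
            C * (∫ y in {y : Eu n | 0 < y ln}, |f y| * (y ln) ^ b) /
              ‖x‖ ^ ((n : ℝ) - 2 + b + k) := by
  refine ⟨fun f hf ⟨M, hM⟩ hsupp x hx =>
    (contDiffAt_Tb ln hb hf hM hsupp hx.2).contDiffWithinAt, fun k => ?_⟩
  obtain ⟨C, hC⟩ := exists_norm_iteratedFDeriv_rescaledTb_le ln hb k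
  set β := ∫ τ in Set.Ioc (0 : ℝ) 1, ‖(τ * (1 - τ)) ^ (b / 2 - 1)‖ with hβ
  refine ⟨|Db n b| * |C| * β + 1, by positivity, fun f hf ⟨M, hM⟩ hsupp x hx0 hx => ?_⟩
  have hr0 : 0 < ‖x‖ := two_pos.trans hx
  set I := ∫ y in {y : Eu n | 0 < y ln}, |f y| * (y ln) ^ b
  have hI : 0 ≤ I := setIntegral_nonneg (measurableSet_halfSpace ln) fun y (hy : 0 < y ln) =>
    mul_nonneg (abs_nonneg _) (Real.rpow_nonneg hy.le b)
  have hbound := hC f hf ⟨M, hM⟩ ‖x‖ hx (‖x‖⁻¹ • x) (norm_inv_norm_smul hx)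
  rw [integral_norm_TbWeight ln b hsupp, ← hβ] at hbound
  have hpow : ‖x‖ ^ (-((n : ℝ) - 2 + b)) * ‖x‖⁻¹ ^ k = (‖x‖ ^ ((n : ℝ) - 2 + b + k))⁻¹ := by
    rw [Real.rpow_add hr0, Real.rpow_neg hr0.le, Real.rpow_natCast, mul_inv, inv_pow]
  rw [iteratedFDerivWithin_eq_iteratedFDeriv (uniqueDiffOn_halfSpace_inter ln)
      ((contDiffAt_Tb ln hb hf hM hsupp hx).of_le (by exact_mod_cast le_top)) ⟨hx0, hx⟩,
    ((Tb_eventuallyEq_rescaledTb ln hb hf hM hsupp hx).iteratedFDeriv ℝ k).eq_of_nhds,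
    norm_iteratedFDeriv_comp_inv_smul, abs_mul, abs_of_nonneg (Real.rpow_nonneg hr0.le _),
    abs_of_nonneg (inv_nonneg.2 hr0.le), mul_assoc |Db n b|, hpow, div_eq_mul_inv]
  calc |Db n b| * (‖x‖ ^ ((n : ℝ) - 2 + b + k))⁻¹ *
        ‖iteratedFDeriv ℝ k (rescaledTb ln b f ‖x‖) (‖x‖⁻¹ • x)‖
      ≤ |Db n b| * (‖x‖ ^ ((n : ℝ) - 2 + b + k))⁻¹ * (|C| * (I * β)) := by
        gcongr
        exact hbound.trans (mul_le_mul_of_nonneg_right (le_abs_self C) (by positivity))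
    _ = |Db n b| * |C| * β * I * (‖x‖ ^ ((n : ℝ) - 2 + b + k))⁻¹ := by ring
    _ ≤ _ := by gcongr; linarith
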